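/- arXiv:1905.08962 — 14 statements merged into one kernel-verified Lean document; each statement's English description precedes it below -/
import Mathlib

section
/- Let Λ be a (C,C')-controlled g-frame for H with bounds A, B, and let S : H → H be a bounded operator such that for every f ∈ H the family (P_i f)_{i∈ι} is summable in H with Σ_{i∈ι} P_i f = S f. Then S is self-adjoint and positive, A‖f‖² ≤ Re⟨S f, f⟩ ≤ B‖f‖² for every f ∈ H, and S is bijective with bounded inverse. -/
/-- The controlled g-frame operator is self-adjoint, positive, satisfies
`A‖f‖² ≤ Re⟨Sf,f⟩ ≤ B‖f‖²`, and is bijective with a bounded inverse. -/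
theorem stmt_2 {H : Type*} [NormedAddCommGroup H] [InnerProductSpace ℂ H] [CompleteSpace H]
    {ι : Type*} {G : ι → Type*} [∀ i, NormedAddCommGroup (G i)]
    [∀ i, InnerProductSpace ℂ (G i)] [∀ i, CompleteSpace (G i)]
    (Λ : ∀ i, H →L[ℂ] G i) (C C' : H →L[ℂ] H)
    (hC : ∃ Ci : H →L[ℂ] H, Ci.comp C = 1 ∧ C.comp Ci = 1)
    (hC' : ∃ Ci : H →L[ℂ] H, Ci.comp C' = 1 ∧ C'.comp Ci = 1)
    (P : ι → H →L[ℂ] H)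
    (hP : ∀ i, P i = (ContinuousLinearMap.adjoint C).comp
      ((ContinuousLinearMap.adjoint (Λ i)).comp ((Λ i).comp C')))
    (hPsa : ∀ i, IsSelfAdjoint (P i))
    (hPpos : ∀ i, ∀ f : H, 0 ≤ (inner ℂ (P i f) f : ℂ).re)
    (Psqrt : ι → H →L[ℂ] H)
    (hPsqsa : ∀ i, IsSelfAdjoint (Psqrt i))
    (hPsqpos : ∀ i, ∀ f : H, 0 ≤ (inner ℂ (Psqrt i f) f : ℂ).re)
    (hPsq : ∀ i, (Psqrt i).comp (Psqrt i) = P i)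
    (A B : ℝ) (hA : 0 < A) (hAB : A ≤ B)
    (hframe : ∀ f : H, Summable (fun i => ‖Psqrt i f‖ ^ 2) ∧
      A * ‖f‖ ^ 2 ≤ ∑' i, ‖Psqrt i f‖ ^ 2 ∧ (∑' i, ‖Psqrt i f‖ ^ 2) ≤ B * ‖f‖ ^ 2)
    (S : H →L[ℂ] H) (hS : ∀ f : H, HasSum (fun i => P i f) (S f)) :
    IsSelfAdjoint S ∧ (∀ f : H, 0 ≤ (inner ℂ (S f) f : ℂ).re) ∧
    (∀ f : H, A * ‖f‖ ^ 2 ≤ (inner ℂ (S f) f : ℂ).re ∧ (inner ℂ (S f) f : ℂ).re ≤ B * ‖f‖ ^ 2) ∧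
    Function.Bijective S ∧ ∃ Si : H →L[ℂ] H, Si.comp S = 1 ∧ S.comp Si = 1 := by
  have symm_apply {T : H →L[ℂ] H} (hT : IsSelfAdjoint T) (f g : H) :
      inner ℂ (T f) g = inner ℂ f (T g) := hT.isSymmetric f g
  have hasSum_inner_right (f g : H) : HasSum (fun i => inner ℂ f (P i g)) (inner ℂ f (S g)) :=
    (hS g).mapL (innerSL ℂ f)
  have hasSum_inner_left (f g : H) : HasSum (fun i => inner ℂ (P i f) g) (inner ℂ (S f) g) := by
    simpa using (hasSum_inner_right g f).star
  have hSsa : IsSelfAdjoint S := by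
    rw [ContinuousLinearMap.isSelfAdjoint_iff_isSymmetric]
    intro f g
    refine (hasSum_inner_left f g).unique ?_
    simp only [symm_apply (hPsa _)]
    exact hasSum_inner_right f g
  have norm_sq_sqrt (i : ι) (f : H) : ‖Psqrt i f‖ ^ 2 = (inner ℂ (P i f) f : ℂ).re := by
    rw [← hPsq i, ContinuousLinearMap.comp_apply, symm_apply (hPsqsa i),
      inner_self_eq_norm_sq_to_K]
    norm_cast
  have tsum_eq (f : H) : ∑' i, ‖Psqrt i f‖ ^ 2 = (inner ℂ (S f) f : ℂ).re := by
    simp only [norm_sq_sqrt]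
    exact (Complex.hasSum_re (hasSum_inner_left f f)).tsum_eq
  have bounds (f : H) : A * ‖f‖ ^ 2 ≤ (inner ℂ (S f) f : ℂ).re ∧
      (inner ℂ (S f) f : ℂ).re ≤ B * ‖f‖ ^ 2 := by
    rw [← tsum_eq f]
    exact (hframe f).2
  have hunit : IsUnit S := by
    refine S.isUnit_of_forall_le_norm_inner_map (c := ⟨A, hA.le⟩) hA fun f => ?_
    calc ‖f‖ ^ 2 * A = A * ‖f‖ ^ 2 := mul_comm _ _
      _ ≤ (inner ℂ (S f) f : ℂ).re := (bounds f).1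
      _ ≤ ‖(inner ℂ (S f) f : ℂ)‖ := Complex.re_le_norm _
  refine ⟨hSsa, fun f => le_trans (by positivity) (bounds f).1, bounds,
    ContinuousLinearMap.isUnit_iff_bijective.mp hunit, ?_⟩
  obtain ⟨u, rfl⟩ := hunit
  exact ⟨↑u⁻¹, u.inv_mul, u.mul_inv⟩
end

section
/- Let Λ be a (C,C')-controlled g-Bessel sequence for H with bound B. Then for all f, g ∈ H the family (⟨P_i f, g⟩)_{i∈ι} is absolutely summable and Σ_{i∈ι} |⟨P_i f, g⟩| ≤ B‖f‖‖g‖; consequently there is a (unique) bounded operator S : H → H with ⟨S f, g⟩ = Σ_{i∈ι} ⟨P_i f, g⟩ for all f, g, and ‖S‖ ≤ B. -/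
/-- Cauchy–Schwarz for square-summable families: `∑ aᵢ bᵢ ≤ √A √B` over finite sets. -/
theorem sum_mul_le_of_tsum_sq_le {ι : Type*} {a b : ι → ℝ} {A B : ℝ}
    (ha : Summable fun i => a i ^ 2) (hA : ∑' i, a i ^ 2 ≤ A)
    (hb : Summable fun i => b i ^ 2) (hB : ∑' i, b i ^ 2 ≤ B) (s : Finset ι) :
    ∑ i ∈ s, a i * b i ≤ √A * √B := by
  refine (Real.sum_mul_le_sqrt_mul_sqrt s a b).trans ?_
  gcongr
  · exact (ha.sum_le_tsum s fun i _ => sq_nonneg _).trans hA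
  · exact (hb.sum_le_tsum s fun i _ => sq_nonneg _).trans hB

/-- A weakly absolutely summable family of operators whose sum of matrix coefficients is bounded
by `B‖f‖‖g‖` has a weak sum of norm at most `B`. -/
theorem exists_weak_sum_of_tsum_norm_inner_le {H : Type*} [NormedAddCommGroup H]
    [InnerProductSpace ℂ H] [CompleteSpace H] {ι : Type*} {P : ι → H →L[ℂ] H} {B : ℝ}
    (hB : 0 ≤ B)
    (hP : ∀ f g : H, Summable (fun i => ‖(inner ℂ (P i f) g : ℂ)‖) ∧
      (∑' i, ‖(inner ℂ (P i f) g : ℂ)‖) ≤ B * ‖f‖ * ‖g‖) :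
    ∃ S : H →L[ℂ] H, ‖S‖ ≤ B ∧
      ∀ f g : H, HasSum (fun i => (inner ℂ (P i f) g : ℂ)) (inner ℂ (S f) g) := by
  have hs (f g : H) : Summable fun i => (inner ℂ (P i f) g : ℂ) := (hP f g).1.of_norm
  let b : H →ₗ⋆[ℂ] H →ₗ[ℂ] ℂ :=
    LinearMap.mk₂'ₛₗ (starRingEnd ℂ) (RingHom.id ℂ) (fun f g => ∑' i, inner ℂ (P i f) g)
      (fun f f' g => by
        simpa only [map_add, inner_add_left] using (hs f g).tsum_add (hs f' g))
      (fun c f g => by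
        simp only [map_smul, inner_smul_left, tsum_mul_left, smul_eq_mul])
      (fun f g g' => by
        simpa only [inner_add_right] using (hs f g).tsum_add (hs f g'))
      (fun c f g => by
        simp only [inner_smul_right, tsum_mul_left, smul_eq_mul, RingHom.id_apply])
  have hb (f g : H) : ‖b f g‖ ≤ B * ‖f‖ * ‖g‖ :=
    (norm_tsum_le_tsum_norm (hP f g).1).trans (hP f g).2
  let S := InnerProductSpace.continuousLinearMapOfBilin (b.mkContinuous₂ B hb)
  have hS (f g : H) : (inner ℂ (S f) g : ℂ) = b f g :=
    InnerProductSpace.continuousLinearMapOfBilin_apply _ f g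
  refine ⟨S, S.opNorm_le_bound hB fun f => ?_, fun f g => hS f g ▸ (hs f g).hasSum⟩
  rcases (norm_nonneg (S f)).eq_or_lt with h | h
  · rw [← h]
    positivity
  · refine le_of_mul_le_mul_right ?_ h
    calc ‖S f‖ * ‖S f‖ = ‖(inner ℂ (S f) (S f) : ℂ)‖ := by
          rw [inner_self_eq_norm_sq_to_K, norm_pow, RCLike.norm_ofReal, abs_norm, sq]
      _ ≤ B * ‖f‖ * ‖S f‖ := hS f (S f) ▸ hb f (S f)

/-- For a `(C,C')`-controlled g-Bessel sequence with bound `B`, the families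
`(⟨P_i f, g⟩)` are absolutely summable with `Σ|⟨P_i f, g⟩| ≤ B‖f‖‖g‖`, and there is a unique
bounded operator `S` with `⟨Sf, g⟩ = Σ⟨P_i f, g⟩` for all `f, g`, with `‖S‖ ≤ B`. -/
theorem stmt_3 {H : Type*} [NormedAddCommGroup H] [InnerProductSpace ℂ H] [CompleteSpace H]
    {ι : Type*} {G : ι → Type*} [∀ i, NormedAddCommGroup (G i)]
    [∀ i, InnerProductSpace ℂ (G i)] [∀ i, CompleteSpace (G i)]
    (Λ : ∀ i, H →L[ℂ] G i) (C C' : H →L[ℂ] H)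
    (hC : ∃ Ci : H →L[ℂ] H, Ci.comp C = 1 ∧ C.comp Ci = 1)
    (hC' : ∃ Ci : H →L[ℂ] H, Ci.comp C' = 1 ∧ C'.comp Ci = 1)
    (P : ι → H →L[ℂ] H)
    (hP : ∀ i, P i = (ContinuousLinearMap.adjoint C).comp
      ((ContinuousLinearMap.adjoint (Λ i)).comp ((Λ i).comp C')))
    (hPsa : ∀ i, IsSelfAdjoint (P i))
    (hPpos : ∀ i, ∀ f : H, 0 ≤ (inner ℂ (P i f) f : ℂ).re)
    (Psqrt : ι → H →L[ℂ] H)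
    (hPsqsa : ∀ i, IsSelfAdjoint (Psqrt i))
    (hPsqpos : ∀ i, ∀ f : H, 0 ≤ (inner ℂ (Psqrt i f) f : ℂ).re)
    (hPsq : ∀ i, (Psqrt i).comp (Psqrt i) = P i)
    (B : ℝ) (hB : 0 < B)
    (hbessel : ∀ f : H, Summable (fun i => ‖Psqrt i f‖ ^ 2) ∧
      (∑' i, ‖Psqrt i f‖ ^ 2) ≤ B * ‖f‖ ^ 2) :
    (∀ f g : H, Summable (fun i => ‖(inner ℂ (P i f) g : ℂ)‖) ∧
      (∑' i, ‖(inner ℂ (P i f) g : ℂ)‖) ≤ B * ‖f‖ * ‖g‖) ∧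
    ∃ S : H →L[ℂ] H, ‖S‖ ≤ B ∧
      (∀ f g : H, HasSum (fun i => (inner ℂ (P i f) g : ℂ)) (inner ℂ (S f) g)) ∧
      ∀ S' : H →L[ℂ] H,
        (∀ f g : H, HasSum (fun i => (inner ℂ (P i f) g : ℂ)) (inner ℂ (S' f) g)) → S' = S := by
  have hinner (i : ι) (f g : H) : (inner ℂ (P i f) g : ℂ) = inner ℂ (Psqrt i f) (Psqrt i g) := by
    rw [← hPsq i, ContinuousLinearMap.comp_apply]
    exact (hPsqsa i).isSymmetric _ _
  have hfin (f g : H) (s : Finset ι) :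
      ∑ i ∈ s, ‖(inner ℂ (P i f) g : ℂ)‖ ≤ B * ‖f‖ * ‖g‖ :=
    calc ∑ i ∈ s, ‖(inner ℂ (P i f) g : ℂ)‖
        ≤ ∑ i ∈ s, ‖Psqrt i f‖ * ‖Psqrt i g‖ :=
          Finset.sum_le_sum fun i _ => hinner i f g ▸ norm_inner_le_norm _ _
      _ ≤ √(B * ‖f‖ ^ 2) * √(B * ‖g‖ ^ 2) :=
          sum_mul_le_of_tsum_sq_le (hbessel f).1 (hbessel f).2 (hbessel g).1 (hbessel g).2 s
      _ = B * ‖f‖ * ‖g‖ := by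
          rw [← Real.sqrt_mul (by positivity),
            show B * ‖f‖ ^ 2 * (B * ‖g‖ ^ 2) = (B * ‖f‖ * ‖g‖) ^ 2 by ring,
            Real.sqrt_sq (by positivity)]
  have habs (f g : H) : Summable (fun i => ‖(inner ℂ (P i f) g : ℂ)‖) ∧
      (∑' i, ‖(inner ℂ (P i f) g : ℂ)‖) ≤ B * ‖f‖ * ‖g‖ :=
    ⟨summable_of_sum_le (fun _ => norm_nonneg _) (hfin f g),
      Real.tsum_le_of_sum_le (fun _ => norm_nonneg _) (hfin f g)⟩
  obtain ⟨S, hSB, hS⟩ := exists_weak_sum_of_tsum_norm_inner_le hB.le habs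
  refine ⟨habs, S, hSB, hS, fun S' hS' => ?_⟩
  ext f
  exact ext_inner_right ℂ fun g => (hS' f g).unique (hS f g)
end

section
/- Suppose there exists a bounded operator S : H → H with ‖S‖ ≤ B such that for every f ∈ H the family (P_i f)_{i∈ι} is summable in H with Σ_{i∈ι} P_i f = S f. Then Λ is a (C,C')-controlled g-Bessel sequence for H with bound B; that is, for every f ∈ H the family (⟨Λ_i C' f, Λ_i C f⟩)_{i∈ι} is summable and Re(Σ_{i∈ι} ⟨Λ_i C' f, Λ_i C f⟩) ≤ B‖f‖². -/
/-- If the operators `P_i` sum pointwise to a bounded operator `S` with `‖S‖ ≤ B`,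
then `Λ` is a `(C,C')`-controlled g-Bessel sequence with bound `B`:
for every `f` the family `(⟨Λ_i C' f, Λ_i C f⟩)` is summable with real part of sum `≤ B‖f‖²`.
(Inner products below are in Mathlib's convention, conjugate-linear in the first slot, so
the paper's `⟨Λ_i C' f, Λ_i C f⟩` reads `inner (Λ i (C f)) (Λ i (C' f))`.) -/
theorem stmt_4 {H : Type*} [NormedAddCommGroup H] [InnerProductSpace ℂ H] [CompleteSpace H]
    {ι : Type*} {G : ι → Type*} [∀ i, NormedAddCommGroup (G i)]
    [∀ i, InnerProductSpace ℂ (G i)] [∀ i, CompleteSpace (G i)]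
    (Λ : ∀ i, H →L[ℂ] G i) (C C' : H →L[ℂ] H)
    (hC : ∃ Ci : H →L[ℂ] H, Ci.comp C = 1 ∧ C.comp Ci = 1)
    (hC' : ∃ Ci : H →L[ℂ] H, Ci.comp C' = 1 ∧ C'.comp Ci = 1)
    (P : ι → H →L[ℂ] H)
    (hP : ∀ i, P i = (ContinuousLinearMap.adjoint C).comp
      ((ContinuousLinearMap.adjoint (Λ i)).comp ((Λ i).comp C')))
    (B : ℝ) (hB : 0 < B)
    (S : H →L[ℂ] H) (hSB : ‖S‖ ≤ B)
    (hS : ∀ f : H, HasSum (fun i => P i f) (S f)) :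
    ∀ f : H, Summable (fun i => (inner ℂ (Λ i (C f)) (Λ i (C' f)) : ℂ)) ∧
      (∑' i, (inner ℂ (Λ i (C f)) (Λ i (C' f)) : ℂ)).re ≤ B * ‖f‖ ^ 2 := by
  intro f
  have hsum : HasSum (fun i => (inner ℂ (Λ i (C f)) (Λ i (C' f)) : ℂ)) (inner ℂ f (S f)) := by
    simpa [hP, ContinuousLinearMap.adjoint_inner_right] using
      (hS f).mapL (innerSL ℂ f)
  refine ⟨hsum.summable, ?_⟩
  rw [hsum.tsum_eq]
  calc (inner ℂ f (S f) : ℂ).re ≤ ‖f‖ * ‖S f‖ := re_inner_le_norm (𝕜 := ℂ) f (S f)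
    _ ≤ ‖f‖ * (B * ‖f‖) := by
      gcongr
      exact S.le_of_opNorm_le hSB f
    _ = B * ‖f‖ ^ 2 := by ring
end

section
/- Let Λ be a (C,C')-controlled g-Bessel sequence for H with bound B, and suppose there exists a bounded linear operator V : H → ℓ²(ι, H) such that for every f ∈ H the family (⟨(V f)_i, P_i^{1/2} f⟩)_{i∈ι} is summable with Σ_{i∈ι} ⟨(V f)_i, P_i^{1/2} f⟩ = ‖f‖². Then for every f ∈ H, (1/‖V‖²)·‖f‖² ≤ Σ_{i∈ι} ‖P_i^{1/2} f‖²; in particular Λ is a (C,C')-controlled g-frame for H with bounds 1/‖V‖² and B. -/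
/-- If `Λ` is a `(C,C')`-controlled g-Bessel sequence with bound `B` and there
is a bounded `V : H → ℓ²(ι, H)` with `Σ_i ⟨(Vf)_i, P_i^{1/2} f⟩ = ‖f‖²` for all `f`, then
`(1/‖V‖²)‖f‖² ≤ Σ_i ‖P_i^{1/2} f‖²`, so `Λ` is a `(C,C')`-controlled g-frame with bounds
`1/‖V‖²` and `B`. (Mathlib's inner product is conjugate-linear in the first slot, so the
paper's `⟨(Vf)_i, P_i^{1/2} f⟩` reads `inner (Psqrt i f) ((V f) i)`.) -/
theorem stmt_5 {H : Type*} [NormedAddCommGroup H] [InnerProductSpace ℂ H] [CompleteSpace H]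
    {ι : Type*} {G : ι → Type*} [∀ i, NormedAddCommGroup (G i)]
    [∀ i, InnerProductSpace ℂ (G i)] [∀ i, CompleteSpace (G i)]
    (Λ : ∀ i, H →L[ℂ] G i) (C C' : H →L[ℂ] H)
    (hC : ∃ Ci : H →L[ℂ] H, Ci.comp C = 1 ∧ C.comp Ci = 1)
    (hC' : ∃ Ci : H →L[ℂ] H, Ci.comp C' = 1 ∧ C'.comp Ci = 1)
    (P : ι → H →L[ℂ] H)
    (hP : ∀ i, P i = (ContinuousLinearMap.adjoint C).comp
      ((ContinuousLinearMap.adjoint (Λ i)).comp ((Λ i).comp C')))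
    (hPsa : ∀ i, IsSelfAdjoint (P i))
    (hPpos : ∀ i, ∀ f : H, 0 ≤ (inner ℂ (P i f) f : ℂ).re)
    (Psqrt : ι → H →L[ℂ] H)
    (hPsqsa : ∀ i, IsSelfAdjoint (Psqrt i))
    (hPsqpos : ∀ i, ∀ f : H, 0 ≤ (inner ℂ (Psqrt i f) f : ℂ).re)
    (hPsq : ∀ i, (Psqrt i).comp (Psqrt i) = P i)
    (B : ℝ) (hB : 0 < B)
    (hbessel : ∀ f : H, Summable (fun i => ‖Psqrt i f‖ ^ 2) ∧
      (∑' i, ‖Psqrt i f‖ ^ 2) ≤ B * ‖f‖ ^ 2)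
    (V : H →L[ℂ] lp (fun _ : ι => H) 2)
    (hV : ∀ f : H, HasSum (fun i => (inner ℂ (Psqrt i f) ((V f : ∀ _ : ι, H) i) : ℂ))
      ((‖f‖ : ℂ) ^ 2)) :
    ∀ f : H, (1 / ‖V‖ ^ 2) * ‖f‖ ^ 2 ≤ ∑' i, ‖Psqrt i f‖ ^ 2 := by
  intro f
  have hmem : Memℓp (fun i => Psqrt i f) 2 := by
    refine memℓp_gen ?_
    simpa using (hbessel f).1
  let x : lp (fun _ : ι => H) 2 := ⟨fun i => Psqrt i f, hmem⟩
  have hnorm : ‖x‖ ^ 2 = ∑' i, ‖Psqrt i f‖ ^ 2 := by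
    simpa [x] using lp.norm_rpow_eq_tsum (p := 2) (by norm_num) x
  have hinner : inner ℂ x (V f) = (‖f‖ : ℂ) ^ 2 :=
    (lp.hasSum_inner x (V f)).unique (hV f)
  have hcauchy : ‖f‖ ^ 2 ≤ ‖x‖ * (‖V‖ * ‖f‖) :=
    calc ‖f‖ ^ 2 = ‖inner ℂ x (V f)‖ := by rw [hinner]; simp
      _ ≤ ‖x‖ * ‖V f‖ := norm_inner_le_norm x (V f)
      _ ≤ ‖x‖ * (‖V‖ * ‖f‖) := by gcongr; exact V.le_opNorm f
  have hle : ‖f‖ ≤ ‖x‖ * ‖V‖ := by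
    rcases (norm_nonneg f).eq_or_lt with hf | hf
    · rw [← hf]; positivity
    · exact le_of_mul_le_mul_right (by linarith) hf
  rw [← hnorm, one_div_mul_eq_div]
  refine div_le_of_le_mul₀ (by positivity) (by positivity) ?_
  rw [← mul_pow]
  gcongr
end

section
/- Let Λ and Θ be (C,C')-controlled g-Bessel sequences for H with bounds B₁ and B₂ respectively, and suppose that for every f ∈ H the family (⟨Q_i^{1/2} f, P_i^{1/2} f⟩)_{i∈ι} is summable with Σ_{i∈ι} ⟨Q_i^{1/2} f, P_i^{1/2} f⟩ = ‖f‖². Then for every f ∈ H, (1/B₂)‖f‖² ≤ Σ_{i∈ι} ‖P_i^{1/2} f‖² and (1/B₁)‖f‖² ≤ Σ_{i∈ι} ‖Q_i^{1/2} f‖²; that is, both Λ and Θ are (C,C')-controlled g-frames for H. -/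
/-- If `∑ Re ⟪x i, y i⟫ = N` and `∑ ‖y i‖² ≤ b N`, then `∑ ‖x i‖² ≥ N / b`. -/
theorem one_div_mul_le_tsum_norm_sq_of_hasSum_re_inner {𝕜 E ι : Type*} [RCLike 𝕜]
    [SeminormedAddCommGroup E] [InnerProductSpace 𝕜 E] {x y : ι → E} {b N : ℝ} (hb : 0 < b)
    (hx : Summable fun i => ‖x i‖ ^ 2) (hy : Summable fun i => ‖y i‖ ^ 2)
    (hyb : ∑' i, ‖y i‖ ^ 2 ≤ b * N)
    (hxy : HasSum (fun i => RCLike.re (inner 𝕜 (x i) (y i))) N) :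
    (1 / b) * N ≤ ∑' i, ‖x i‖ ^ 2 := by
  have young : ∀ i, 2 * b * RCLike.re (inner 𝕜 (x i) (y i)) ≤ b ^ 2 * ‖x i‖ ^ 2 + ‖y i‖ ^ 2 := by
    intro i
    have h := mul_le_mul_of_nonneg_left (re_inner_le_norm (𝕜 := 𝕜) (x i) (y i)) hb.le
    nlinarith [sq_nonneg (b * ‖x i‖ - ‖y i‖)]
  have hle := hasSum_le young (hxy.mul_left (2 * b)) ((hx.hasSum.mul_left (b ^ 2)).add hy.hasSum)
  rw [one_div, inv_mul_le_iff₀ hb]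
  refine le_of_mul_le_mul_left ?_ hb
  linarith

/-- If `Λ`, `Θ` are `(C,C')`-controlled g-Bessel sequences with bounds `B₁`, `B₂`
and `Σ_i ⟨Q_i^{1/2} f, P_i^{1/2} f⟩ = ‖f‖²` for every `f`, then both are controlled g-frames:
`(1/B₂)‖f‖² ≤ Σ_i ‖P_i^{1/2} f‖²` and `(1/B₁)‖f‖² ≤ Σ_i ‖Q_i^{1/2} f‖²`.
(Mathlib's inner product is conjugate-linear in the first slot, so the paper's
`⟨Q_i^{1/2} f, P_i^{1/2} f⟩` reads `inner (Psqrt i f) (Qsqrt i f)`.) -/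
theorem stmt_6 {H : Type*} [NormedAddCommGroup H] [InnerProductSpace ℂ H] [CompleteSpace H]
    {ι : Type*} {G : ι → Type*} [∀ i, NormedAddCommGroup (G i)]
    [∀ i, InnerProductSpace ℂ (G i)] [∀ i, CompleteSpace (G i)]
    (Λ Θ : ∀ i, H →L[ℂ] G i) (C C' : H →L[ℂ] H)
    (hC : ∃ Ci : H →L[ℂ] H, Ci.comp C = 1 ∧ C.comp Ci = 1)
    (hC' : ∃ Ci : H →L[ℂ] H, Ci.comp C' = 1 ∧ C'.comp Ci = 1)
    (P Q : ι → H →L[ℂ] H)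
    (hP : ∀ i, P i = (ContinuousLinearMap.adjoint C).comp
      ((ContinuousLinearMap.adjoint (Λ i)).comp ((Λ i).comp C')))
    (hQ : ∀ i, Q i = (ContinuousLinearMap.adjoint C).comp
      ((ContinuousLinearMap.adjoint (Θ i)).comp ((Θ i).comp C')))
    (hPsa : ∀ i, IsSelfAdjoint (P i)) (hQsa : ∀ i, IsSelfAdjoint (Q i))
    (hPpos : ∀ i, ∀ f : H, 0 ≤ (inner ℂ (P i f) f : ℂ).re)
    (hQpos : ∀ i, ∀ f : H, 0 ≤ (inner ℂ (Q i f) f : ℂ).re)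
    (Psqrt Qsqrt : ι → H →L[ℂ] H)
    (hPsqsa : ∀ i, IsSelfAdjoint (Psqrt i)) (hQsqsa : ∀ i, IsSelfAdjoint (Qsqrt i))
    (hPsqpos : ∀ i, ∀ f : H, 0 ≤ (inner ℂ (Psqrt i f) f : ℂ).re)
    (hQsqpos : ∀ i, ∀ f : H, 0 ≤ (inner ℂ (Qsqrt i f) f : ℂ).re)
    (hPsq : ∀ i, (Psqrt i).comp (Psqrt i) = P i)
    (hQsq : ∀ i, (Qsqrt i).comp (Qsqrt i) = Q i)
    (B₁ B₂ : ℝ) (hB₁ : 0 < B₁) (hB₂ : 0 < B₂)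
    (hbesselP : ∀ f : H, Summable (fun i => ‖Psqrt i f‖ ^ 2) ∧
      (∑' i, ‖Psqrt i f‖ ^ 2) ≤ B₁ * ‖f‖ ^ 2)
    (hbesselQ : ∀ f : H, Summable (fun i => ‖Qsqrt i f‖ ^ 2) ∧
      (∑' i, ‖Qsqrt i f‖ ^ 2) ≤ B₂ * ‖f‖ ^ 2)
    (hdual : ∀ f : H, HasSum (fun i => (inner ℂ (Psqrt i f) (Qsqrt i f) : ℂ)) ((‖f‖ : ℂ) ^ 2)) :
    ∀ f : H, (1 / B₂) * ‖f‖ ^ 2 ≤ (∑' i, ‖Psqrt i f‖ ^ 2) ∧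
      (1 / B₁) * ‖f‖ ^ 2 ≤ ∑' i, ‖Qsqrt i f‖ ^ 2 := by
  intro f
  have hre : HasSum (fun i => RCLike.re (inner ℂ (Psqrt i f) (Qsqrt i f))) (‖f‖ ^ 2) := by
    have h := Complex.hasSum_re (hdual f)
    rwa [← Complex.ofReal_pow, Complex.ofReal_re] at h
  obtain ⟨hPs, hPb⟩ := hbesselP f
  obtain ⟨hQs, hQb⟩ := hbesselQ f
  refine ⟨one_div_mul_le_tsum_norm_sq_of_hasSum_re_inner (𝕜 := ℂ) hB₂ hPs hQs hQb hre,
    one_div_mul_le_tsum_norm_sq_of_hasSum_re_inner (𝕜 := ℂ) hB₁ hQs hPs hPb ?_⟩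
  simpa only [inner_re_symm] using hre
end

section
/- Let Λ be a (C,C')-controlled g-frame for H, let S be its controlled g-frame operator (bounded, positive, bijective with bounded inverse), and let S^{-1/2} denote the unique positive square root of S⁻¹. Assume S^{-1/2} ∘ C = C ∘ S^{-1/2} and S^{-1/2} ∘ C' = C' ∘ S^{-1/2}. Then the family (Λ_i ∘ S^{-1/2})_{i∈ι} is a Parseval (C,C')-controlled g-frame for H: for every f ∈ H the family (⟨Λ_i S^{-1/2} C' f, Λ_i S^{-1/2} C f⟩)_{i∈ι} is summable with sum equal to ‖f‖². -/
/-- If `Λ` is a `(C,C')`-controlled g-frame with frame operator `S`, and `S^{-1/2}`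
(the positive square root `R` of `S⁻¹`) commutes with `C` and `C'`, then `(Λ_i ∘ S^{-1/2})` is a
Parseval `(C,C')`-controlled g-frame: `Σ_i ⟨Λ_i S^{-1/2} C' f, Λ_i S^{-1/2} C f⟩ = ‖f‖²`.
(Mathlib's inner product is conjugate-linear in the first slot, so the paper's summand reads
`inner (Λ i (R (C f))) (Λ i (R (C' f)))`.) -/
theorem stmt_7 {H : Type*} [NormedAddCommGroup H] [InnerProductSpace ℂ H] [CompleteSpace H]
    {ι : Type*} {G : ι → Type*} [∀ i, NormedAddCommGroup (G i)]
    [∀ i, InnerProductSpace ℂ (G i)] [∀ i, CompleteSpace (G i)]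
    (Λ : ∀ i, H →L[ℂ] G i) (C C' : H →L[ℂ] H)
    (hC : ∃ Ci : H →L[ℂ] H, Ci.comp C = 1 ∧ C.comp Ci = 1)
    (hC' : ∃ Ci : H →L[ℂ] H, Ci.comp C' = 1 ∧ C'.comp Ci = 1)
    (P : ι → H →L[ℂ] H)
    (hP : ∀ i, P i = (ContinuousLinearMap.adjoint C).comp
      ((ContinuousLinearMap.adjoint (Λ i)).comp ((Λ i).comp C')))
    (hPsa : ∀ i, IsSelfAdjoint (P i))
    (hPpos : ∀ i, ∀ f : H, 0 ≤ (inner ℂ (P i f) f : ℂ).re)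
    (Psqrt : ι → H →L[ℂ] H)
    (hPsqsa : ∀ i, IsSelfAdjoint (Psqrt i))
    (hPsqpos : ∀ i, ∀ f : H, 0 ≤ (inner ℂ (Psqrt i f) f : ℂ).re)
    (hPsq : ∀ i, (Psqrt i).comp (Psqrt i) = P i)
    (A B : ℝ) (hA : 0 < A) (hAB : A ≤ B)
    (hframe : ∀ f : H, Summable (fun i => ‖Psqrt i f‖ ^ 2) ∧
      A * ‖f‖ ^ 2 ≤ ∑' i, ‖Psqrt i f‖ ^ 2 ∧ (∑' i, ‖Psqrt i f‖ ^ 2) ≤ B * ‖f‖ ^ 2)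
    (S : H →L[ℂ] H) (hS : ∀ f : H, HasSum (fun i => P i f) (S f))
    (hSsa : IsSelfAdjoint S) (hSpos : ∀ f : H, 0 ≤ (inner ℂ (S f) f : ℂ).re)
    (Sinv : H →L[ℂ] H) (hSinv : Sinv.comp S = 1 ∧ S.comp Sinv = 1)
    (R : H →L[ℂ] H) (hRsa : IsSelfAdjoint R)
    (hRpos : ∀ f : H, 0 ≤ (inner ℂ (R f) f : ℂ).re)
    (hRsq : R.comp R = Sinv)
    (hRC : R.comp C = C.comp R) (hRC' : R.comp C' = C'.comp R) :
    ∀ f : H, HasSum (fun i => (inner ℂ (Λ i (R (C f))) (Λ i (R (C' f))) : ℂ))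
      ((‖f‖ : ℂ) ^ 2) := by
  intro f
  obtain ⟨hleft, hright⟩ := hSinv
  have hRSR : R * S * R = 1 := by
    have h₁ : R * (R * S) = 1 := by
      rw [← mul_assoc]
      exact (congrArg (fun T => T * S) hRsq).trans hleft
    have h₂ : S * R * R = 1 := by
      rw [mul_assoc]
      exact (congrArg (fun T => S * T) hRsq).trans hright
    rw [← left_inv_eq_right_inv h₂ h₁, h₂]
  have hterm : ∀ i, inner ℂ (R f) (P i (R f)) =
      (inner ℂ (Λ i (R (C f))) (Λ i (R (C' f))) : ℂ) := by
    intro i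
    have hc : R (C f) = C (R f) := DFunLike.congr_fun hRC f
    have hc' : R (C' f) = C' (R f) := DFunLike.congr_fun hRC' f
    simp only [hP, ContinuousLinearMap.comp_apply, ContinuousLinearMap.adjoint_inner_right, hc, hc']
  have hsum : (inner ℂ (R f) (S (R f)) : ℂ) = (‖f‖ : ℂ) ^ 2 := by
    have hf : R (S (R f)) = f := DFunLike.congr_fun hRSR f
    rw [← ContinuousLinearMap.adjoint_inner_right, hRsa.adjoint_eq, hf]
    exact inner_self_eq_norm_sq_to_K f
  have key := (innerSL ℂ (R f)).hasSum (hS (R f))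
  simpa only [innerSL_apply_apply, Function.comp_def, hterm, hsum] using key
end

section
/- Let Λ and Θ be (C,C')-controlled g-Bessel sequences for H. Then the following are equivalent: (i) for all f, g ∈ H, Σ_{i∈ι} ⟨P_i^{1/2} Q_i^{1/2} f, g⟩ = ⟨f, g⟩; (ii) for all f, g ∈ H, Σ_{i∈ι} ⟨Q_i^{1/2} P_i^{1/2} f, g⟩ = ⟨f, g⟩; (iii) for all f, g ∈ H, ⟨f, g⟩ = Σ_{i∈ι} ⟨Q_i^{1/2} f, P_i^{1/2} g⟩ (all the families above being summable). -/
open scoped InnerProductSpace in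
/-- The weak resolutions of the identity by `S i ∘ T i` and by `T i ∘ S i` imply one another when
all operators are self-adjoint, as the two families are adjoint to each other. -/
theorem hasSum_inner_comp_swap {H ι : Type*} [NormedAddCommGroup H] [InnerProductSpace ℂ H]
    [CompleteSpace H] {S T : ι → H →L[ℂ] H} (hS : ∀ i, IsSelfAdjoint (S i))
    (hT : ∀ i, IsSelfAdjoint (T i))
    (h : ∀ f g : H, HasSum (fun i => ⟪S i (T i f), g⟫_ℂ) ⟪f, g⟫_ℂ) (f g : H) :
    HasSum (fun i => ⟪T i (S i f), g⟫_ℂ) ⟪f, g⟫_ℂ := by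
  have hconj := (h g f).star
  simp only [RCLike.star_def, inner_conj_symm] at hconj
  convert hconj using 2 with i
  exact ((hT i).isSymmetric (S i f) g).trans ((hS i).isSymmetric f (T i g))

/-- For `(C,C')`-controlled g-Bessel sequences `Λ`, `Θ`, the following are
equivalent: (i) `Σ⟨P_i^{1/2}Q_i^{1/2}f, g⟩ = ⟨f,g⟩`; (ii) `Σ⟨Q_i^{1/2}P_i^{1/2}f, g⟩ = ⟨f,g⟩`;
(iii) `⟨f,g⟩ = Σ⟨Q_i^{1/2}f, P_i^{1/2}g⟩` (for all `f, g`). Stated uniformly in Mathlib's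
inner-product convention (conjugate-linear in the first slot), which is equivalent to the
paper's convention by conjugating throughout. -/
theorem stmt_8 {H : Type*} [NormedAddCommGroup H] [InnerProductSpace ℂ H] [CompleteSpace H]
    {ι : Type*} {G : ι → Type*} [∀ i, NormedAddCommGroup (G i)]
    [∀ i, InnerProductSpace ℂ (G i)] [∀ i, CompleteSpace (G i)]
    (Λ Θ : ∀ i, H →L[ℂ] G i) (C C' : H →L[ℂ] H)
    (hC : ∃ Ci : H →L[ℂ] H, Ci.comp C = 1 ∧ C.comp Ci = 1)
    (hC' : ∃ Ci : H →L[ℂ] H, Ci.comp C' = 1 ∧ C'.comp Ci = 1)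
    (P Q : ι → H →L[ℂ] H)
    (hP : ∀ i, P i = (ContinuousLinearMap.adjoint C).comp
      ((ContinuousLinearMap.adjoint (Λ i)).comp ((Λ i).comp C')))
    (hQ : ∀ i, Q i = (ContinuousLinearMap.adjoint C).comp
      ((ContinuousLinearMap.adjoint (Θ i)).comp ((Θ i).comp C')))
    (hPsa : ∀ i, IsSelfAdjoint (P i)) (hQsa : ∀ i, IsSelfAdjoint (Q i))
    (hPpos : ∀ i, ∀ f : H, 0 ≤ (inner ℂ (P i f) f : ℂ).re)
    (hQpos : ∀ i, ∀ f : H, 0 ≤ (inner ℂ (Q i f) f : ℂ).re)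
    (Psqrt Qsqrt : ι → H →L[ℂ] H)
    (hPsqsa : ∀ i, IsSelfAdjoint (Psqrt i)) (hQsqsa : ∀ i, IsSelfAdjoint (Qsqrt i))
    (hPsqpos : ∀ i, ∀ f : H, 0 ≤ (inner ℂ (Psqrt i f) f : ℂ).re)
    (hQsqpos : ∀ i, ∀ f : H, 0 ≤ (inner ℂ (Qsqrt i f) f : ℂ).re)
    (hPsq : ∀ i, (Psqrt i).comp (Psqrt i) = P i)
    (hQsq : ∀ i, (Qsqrt i).comp (Qsqrt i) = Q i)
    (B₁ B₂ : ℝ) (hB₁ : 0 < B₁) (hB₂ : 0 < B₂)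
    (hbesselP : ∀ f : H, Summable (fun i => ‖Psqrt i f‖ ^ 2) ∧
      (∑' i, ‖Psqrt i f‖ ^ 2) ≤ B₁ * ‖f‖ ^ 2)
    (hbesselQ : ∀ f : H, Summable (fun i => ‖Qsqrt i f‖ ^ 2) ∧
      (∑' i, ‖Qsqrt i f‖ ^ 2) ≤ B₂ * ‖f‖ ^ 2) :
    ((∀ f g : H, HasSum (fun i => (inner ℂ (Psqrt i (Qsqrt i f)) g : ℂ)) (inner ℂ f g)) ↔
      (∀ f g : H, HasSum (fun i => (inner ℂ (Qsqrt i (Psqrt i f)) g : ℂ)) (inner ℂ f g))) ∧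
    ((∀ f g : H, HasSum (fun i => (inner ℂ (Qsqrt i (Psqrt i f)) g : ℂ)) (inner ℂ f g)) ↔
      (∀ f g : H, HasSum (fun i => (inner ℂ (Qsqrt i f) (Psqrt i g) : ℂ)) (inner ℂ f g))) := by
  have h_move : ∀ (f g : H) (i : ι),
      (inner ℂ (Psqrt i (Qsqrt i f)) g : ℂ) = inner ℂ (Qsqrt i f) (Psqrt i g) :=
    fun f g i => (hPsqsa i).isSymmetric (Qsqrt i f) g
  have h_swap : (∀ f g : H,
      HasSum (fun i => (inner ℂ (Psqrt i (Qsqrt i f)) g : ℂ)) (inner ℂ f g)) ↔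
      (∀ f g : H, HasSum (fun i => (inner ℂ (Qsqrt i (Psqrt i f)) g : ℂ)) (inner ℂ f g)) :=
    ⟨hasSum_inner_comp_swap hPsqsa hQsqsa, hasSum_inner_comp_swap hQsqsa hPsqsa⟩
  refine ⟨h_swap, h_swap.symm.trans ?_⟩
  simp only [h_move]
end

section
/- Let Λ and Θ be (C,C')-controlled g-Bessel sequences for H with bounds B₁ and B₂ respectively. Then for every subset J ⊆ ι and all f, g ∈ H, the family (⟨Q_i^{1/2} f, P_i^{1/2} g⟩)_{i∈J} is absolutely summable and Σ_{i∈J} |⟨Q_i^{1/2} f, P_i^{1/2} g⟩| ≤ √(B₁B₂)·‖f‖·‖g‖. -/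
/-- Cauchy–Schwarz for two square-summable families of vectors: the inner products are absolutely
summable, with the expected bound. -/
theorem summable_norm_inner_and_tsum_le {𝕜 E κ : Type*} [RCLike 𝕜] [NormedAddCommGroup E]
    [InnerProductSpace 𝕜 E] {u v : κ → E} {a b : ℝ}
    (hu : Summable fun i => ‖u i‖ ^ 2) (hua : ∑' i, ‖u i‖ ^ 2 ≤ a)
    (hv : Summable fun i => ‖v i‖ ^ 2) (hvb : ∑' i, ‖v i‖ ^ 2 ≤ b) :
    (Summable fun i => ‖inner 𝕜 (u i) (v i)‖) ∧
      ∑' i, ‖inner 𝕜 (u i) (v i)‖ ≤ √a * √b := by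
  have bound (s : Finset κ) : ∑ i ∈ s, ‖inner 𝕜 (u i) (v i)‖ ≤ √a * √b :=
    calc ∑ i ∈ s, ‖inner 𝕜 (u i) (v i)‖
        ≤ ∑ i ∈ s, ‖u i‖ * ‖v i‖ := Finset.sum_le_sum fun i _ => norm_inner_le_norm _ _
      _ ≤ √(∑ i ∈ s, ‖u i‖ ^ 2) * √(∑ i ∈ s, ‖v i‖ ^ 2) :=
        Real.sum_mul_le_sqrt_mul_sqrt s _ _
      _ ≤ √a * √b := by
        gcongr
        · exact (hu.sum_le_tsum s fun i _ => sq_nonneg _).trans hua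
        · exact (hv.sum_le_tsum s fun i _ => sq_nonneg _).trans hvb
  exact ⟨summable_of_sum_le (fun i => norm_nonneg _) bound,
    Real.tsum_le_of_sum_le (fun i => norm_nonneg _) bound⟩

/-- For `(C,C')`-controlled g-Bessel sequences `Λ`, `Θ` with bounds `B₁`, `B₂`,
for every `J ⊆ ι` and `f, g ∈ H`, the family `(⟨Q_i^{1/2} f, P_i^{1/2} g⟩)_{i∈J}` is absolutely
summable with `Σ_{i∈J} |⟨Q_i^{1/2} f, P_i^{1/2} g⟩| ≤ √(B₁B₂)‖f‖‖g‖`. -/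
theorem stmt_11 {H : Type*} [NormedAddCommGroup H] [InnerProductSpace ℂ H] [CompleteSpace H]
    {ι : Type*} {G : ι → Type*} [∀ i, NormedAddCommGroup (G i)]
    [∀ i, InnerProductSpace ℂ (G i)] [∀ i, CompleteSpace (G i)]
    (Λ Θ : ∀ i, H →L[ℂ] G i) (C C' : H →L[ℂ] H)
    (hC : ∃ Ci : H →L[ℂ] H, Ci.comp C = 1 ∧ C.comp Ci = 1)
    (hC' : ∃ Ci : H →L[ℂ] H, Ci.comp C' = 1 ∧ C'.comp Ci = 1)
    (P Q : ι → H →L[ℂ] H)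
    (hP : ∀ i, P i = (ContinuousLinearMap.adjoint C).comp
      ((ContinuousLinearMap.adjoint (Λ i)).comp ((Λ i).comp C')))
    (hQ : ∀ i, Q i = (ContinuousLinearMap.adjoint C).comp
      ((ContinuousLinearMap.adjoint (Θ i)).comp ((Θ i).comp C')))
    (hPsa : ∀ i, IsSelfAdjoint (P i)) (hQsa : ∀ i, IsSelfAdjoint (Q i))
    (hPpos : ∀ i, ∀ f : H, 0 ≤ (inner ℂ (P i f) f : ℂ).re)
    (hQpos : ∀ i, ∀ f : H, 0 ≤ (inner ℂ (Q i f) f : ℂ).re)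
    (Psqrt Qsqrt : ι → H →L[ℂ] H)
    (hPsqsa : ∀ i, IsSelfAdjoint (Psqrt i)) (hQsqsa : ∀ i, IsSelfAdjoint (Qsqrt i))
    (hPsqpos : ∀ i, ∀ f : H, 0 ≤ (inner ℂ (Psqrt i f) f : ℂ).re)
    (hQsqpos : ∀ i, ∀ f : H, 0 ≤ (inner ℂ (Qsqrt i f) f : ℂ).re)
    (hPsq : ∀ i, (Psqrt i).comp (Psqrt i) = P i)
    (hQsq : ∀ i, (Qsqrt i).comp (Qsqrt i) = Q i)
    (B₁ B₂ : ℝ) (hB₁ : 0 < B₁) (hB₂ : 0 < B₂)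
    (hbesselP : ∀ f : H, Summable (fun i => ‖Psqrt i f‖ ^ 2) ∧
      (∑' i, ‖Psqrt i f‖ ^ 2) ≤ B₁ * ‖f‖ ^ 2)
    (hbesselQ : ∀ f : H, Summable (fun i => ‖Qsqrt i f‖ ^ 2) ∧
      (∑' i, ‖Qsqrt i f‖ ^ 2) ≤ B₂ * ‖f‖ ^ 2) :
    ∀ (J : Set ι) (f g : H),
      Summable (fun i : J => ‖(inner ℂ (Qsqrt (i : ι) f) (Psqrt (i : ι) g) : ℂ)‖) ∧
      (∑' i : J, ‖(inner ℂ (Qsqrt (i : ι) f) (Psqrt (i : ι) g) : ℂ)‖) ≤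
        Real.sqrt (B₁ * B₂) * ‖f‖ * ‖g‖ := by
  intro J f g
  obtain ⟨hQf, hQB⟩ := hbesselQ f
  obtain ⟨hPg, hPB⟩ := hbesselP g
  have h := summable_norm_inner_and_tsum_le (𝕜 := ℂ)
    (u := fun i : J => Qsqrt i f) (v := fun i : J => Psqrt i g)
    (hQf.subtype J) ((hQf.tsum_subtype_le _ J fun i => sq_nonneg _).trans hQB)
    (hPg.subtype J) ((hPg.tsum_subtype_le _ J fun i => sq_nonneg _).trans hPB)
  refine ⟨h.1, h.2.trans_eq ?_⟩
  rw [Real.sqrt_mul hB₂.le, Real.sqrt_mul hB₁.le, Real.sqrt_mul hB₁.le,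
    Real.sqrt_sq (norm_nonneg f), Real.sqrt_sq (norm_nonneg g)]
  ring
end

section
/- Let Λ be a Parseval (C,C')-controlled g-frame for H, let J ⊆ ι, and suppose S_J and S_{J^c} are bounded operators on H such that for every f ∈ H the families (P_i f)_{i∈J} and (P_i f)_{i∈J^c} are summable in H with sums S_J f and S_{J^c} f respectively. Then for every f ∈ H: Σ_{i∈J} ‖P_i^{1/2} f‖² − ‖S_J f‖² = Σ_{i∈J^c} ‖P_i^{1/2} f‖² − ‖S_{J^c} f‖². -/
/-- If the `T i` are self-adjoint and `∑ T i (T i f) = s`, then `∑ ‖T i f‖ ^ 2 = re ⟪f, s⟫`. -/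
theorem hasSum_norm_sq_of_isSelfAdjoint {H κ : Type*} [NormedAddCommGroup H]
    [InnerProductSpace ℂ H] [CompleteSpace H] {T : κ → H →L[ℂ] H}
    (hT : ∀ i, IsSelfAdjoint (T i)) {f s : H} (hs : HasSum (fun i => T i (T i f)) s) :
    HasSum (fun i => ‖T i f‖ ^ 2) (inner ℂ f s).re := by
  have hre := Complex.hasSum_re (hs.mapL (innerSL ℂ f))
  have hterm (i : κ) : (inner ℂ f (T i (T i f))).re = ‖T i f‖ ^ 2 := by
    rw [← ContinuousLinearMap.adjoint_inner_left, (hT i).adjoint_eq]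
    exact inner_self_eq_norm_sq (𝕜 := ℂ) (T i f)
  simpa only [innerSL_apply_apply, hterm] using hre

/-- For a Parseval `(C,C')`-controlled g-frame with partial sum operators
`S_J`, `S_{J^c}`: `Σ_{i∈J} ‖P_i^{1/2}f‖² − ‖S_J f‖² = Σ_{i∈J^c} ‖P_i^{1/2}f‖² − ‖S_{J^c} f‖²`. -/
theorem stmt_13 {H : Type*} [NormedAddCommGroup H] [InnerProductSpace ℂ H] [CompleteSpace H]
    {ι : Type*} {G : ι → Type*} [∀ i, NormedAddCommGroup (G i)]
    [∀ i, InnerProductSpace ℂ (G i)] [∀ i, CompleteSpace (G i)]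
    (Λ : ∀ i, H →L[ℂ] G i) (C C' : H →L[ℂ] H)
    (hC : ∃ Ci : H →L[ℂ] H, Ci.comp C = 1 ∧ C.comp Ci = 1)
    (hC' : ∃ Ci : H →L[ℂ] H, Ci.comp C' = 1 ∧ C'.comp Ci = 1)
    (P : ι → H →L[ℂ] H)
    (hP : ∀ i, P i = (ContinuousLinearMap.adjoint C).comp
      ((ContinuousLinearMap.adjoint (Λ i)).comp ((Λ i).comp C')))
    (hPsa : ∀ i, IsSelfAdjoint (P i))
    (hPpos : ∀ i, ∀ f : H, 0 ≤ (inner ℂ (P i f) f : ℂ).re)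
    (Psqrt : ι → H →L[ℂ] H)
    (hPsqsa : ∀ i, IsSelfAdjoint (Psqrt i))
    (hPsqpos : ∀ i, ∀ f : H, 0 ≤ (inner ℂ (Psqrt i f) f : ℂ).re)
    (hPsq : ∀ i, (Psqrt i).comp (Psqrt i) = P i)
    (hparseval : ∀ f : H, HasSum (fun i => P i f) f)
    (J : Set ι) (SJ SJc : H →L[ℂ] H)
    (hSJ : ∀ f : H, HasSum (fun i : J => P (i : ι) f) (SJ f))
    (hSJc : ∀ f : H, HasSum (fun i : ↥Jᶜ => P (i : ι) f) (SJc f)) :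
    ∀ f : H, (∑' i : J, ‖Psqrt (i : ι) f‖ ^ 2) - ‖SJ f‖ ^ 2 =
      (∑' i : ↥Jᶜ, ‖Psqrt (i : ι) f‖ ^ 2) - ‖SJc f‖ ^ 2 := by
  intro f
  have hsum (K : Set ι) (s : H) (hs : HasSum (fun i : K => P (i : ι) f) s) :
      ∑' i : K, ‖Psqrt (i : ι) f‖ ^ 2 = (inner ℂ f s).re := by
    refine (hasSum_norm_sq_of_isSelfAdjoint (fun i : K => hPsqsa i) ?_).tsum_eq
    simpa only [← hPsq, ContinuousLinearMap.comp_apply] using hs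
  have hadd : f = SJ f + SJc f :=
    (hparseval f).unique ((hSJ f).add_compl (hSJc f))
  have hself (x : H) : (inner ℂ x x).re = ‖x‖ ^ 2 := inner_self_eq_norm_sq (𝕜 := ℂ) x
  have hsymm : (inner ℂ (SJc f) (SJ f)).re = (inner ℂ (SJ f) (SJc f)).re :=
    inner_re_symm (𝕜 := ℂ) _ _
  have hJ : (inner ℂ f (SJ f)).re = ‖SJ f‖ ^ 2 + (inner ℂ (SJc f) (SJ f)).re := by
    rw [← hself, ← Complex.add_re, ← inner_add_left, ← hadd]
  have hJc : (inner ℂ f (SJc f)).re = (inner ℂ (SJ f) (SJc f)).re + ‖SJc f‖ ^ 2 := by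
    rw [← hself, ← Complex.add_re, ← inner_add_left, ← hadd]
  rw [hsum J _ (hSJ f), hsum Jᶜ _ (hSJc f)]
  linarith
end

section
/- Let Λ be a Parseval (C,C')-controlled g-frame for H, let J ⊆ ι, and suppose S_J and S_{J^c} are bounded operators on H such that for every f ∈ H the families (P_i f)_{i∈J} and (P_i f)_{i∈J^c} are summable in H with sums S_J f and S_{J^c} f respectively. Then for every f ∈ H: Σ_{i∈J} ‖P_i^{1/2} f‖² + ‖S_{J^c} f‖² ≥ (3/4)‖f‖². -/
/-- If `T` is self-adjoint then `‖T f‖² = Re ⟪f, T (T f)⟫`. -/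
theorem IsSelfAdjoint.norm_apply_sq_eq_re_inner {H : Type*} [NormedAddCommGroup H]
    [InnerProductSpace ℂ H] [CompleteSpace H] {T : H →L[ℂ] H} (hT : IsSelfAdjoint T) (f : H) :
    ‖T f‖ ^ 2 = (inner ℂ f (T (T f)) : ℂ).re := by
  have h := ContinuousLinearMap.apply_norm_sq_eq_inner_adjoint_right T f
  rw [hT.adjoint_eq] at h
  exact h

/-- Completing the square: `‖f‖² - Re ⟪f, g⟫ + ‖g‖² ≥ (3/4) ‖f‖²`. -/
theorem three_fourths_norm_sq_le_re_inner_sub_add {H : Type*} [NormedAddCommGroup H]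
    [InnerProductSpace ℂ H] (f g : H) :
    (3 / 4) * ‖f‖ ^ 2 ≤ (inner ℂ f (f - g) : ℂ).re + ‖g‖ ^ 2 := by
  have hff : (inner ℂ f f : ℂ).re = ‖f‖ ^ 2 := inner_self_eq_norm_sq (𝕜 := ℂ) f
  have hfg : (inner ℂ f g : ℂ).re ≤ ‖f‖ * ‖g‖ := re_inner_le_norm (𝕜 := ℂ) f g
  rw [inner_sub_right, Complex.sub_re, hff]
  nlinarith [sq_nonneg (‖g‖ - ‖f‖ / 2)]

/-- For a Parseval `(C,C')`-controlled g-frame with partial sum operators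
`S_J`, `S_{J^c}`: `Σ_{i∈J} ‖P_i^{1/2}f‖² + ‖S_{J^c} f‖² ≥ (3/4)‖f‖²`. -/
theorem stmt_14 {H : Type*} [NormedAddCommGroup H] [InnerProductSpace ℂ H] [CompleteSpace H]
    {ι : Type*} {G : ι → Type*} [∀ i, NormedAddCommGroup (G i)]
    [∀ i, InnerProductSpace ℂ (G i)] [∀ i, CompleteSpace (G i)]
    (Λ : ∀ i, H →L[ℂ] G i) (C C' : H →L[ℂ] H)
    (hC : ∃ Ci : H →L[ℂ] H, Ci.comp C = 1 ∧ C.comp Ci = 1)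
    (hC' : ∃ Ci : H →L[ℂ] H, Ci.comp C' = 1 ∧ C'.comp Ci = 1)
    (P : ι → H →L[ℂ] H)
    (hP : ∀ i, P i = (ContinuousLinearMap.adjoint C).comp
      ((ContinuousLinearMap.adjoint (Λ i)).comp ((Λ i).comp C')))
    (hPsa : ∀ i, IsSelfAdjoint (P i))
    (hPpos : ∀ i, ∀ f : H, 0 ≤ (inner ℂ (P i f) f : ℂ).re)
    (Psqrt : ι → H →L[ℂ] H)
    (hPsqsa : ∀ i, IsSelfAdjoint (Psqrt i))
    (hPsqpos : ∀ i, ∀ f : H, 0 ≤ (inner ℂ (Psqrt i f) f : ℂ).re)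
    (hPsq : ∀ i, (Psqrt i).comp (Psqrt i) = P i)
    (hparseval : ∀ f : H, HasSum (fun i => P i f) f)
    (J : Set ι) (SJ SJc : H →L[ℂ] H)
    (hSJ : ∀ f : H, HasSum (fun i : J => P (i : ι) f) (SJ f))
    (hSJc : ∀ f : H, HasSum (fun i : ↥Jᶜ => P (i : ι) f) (SJc f)) :
    ∀ f : H, (3 / 4) * ‖f‖ ^ 2 ≤ (∑' i : J, ‖Psqrt (i : ι) f‖ ^ 2) + ‖SJc f‖ ^ 2 := by
  intro f
  have hsum : ∑' i : J, ‖Psqrt (i : ι) f‖ ^ 2 = (inner ℂ f (SJ f) : ℂ).re := by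
    refine HasSum.tsum_eq ?_
    have hre := Complex.hasSum_re ((hSJ f).mapL (innerSL ℂ f))
    simp only [innerSL_apply_apply] at hre
    convert hre using 2 with i
    rw [(hPsqsa i).norm_apply_sq_eq_re_inner, ← hPsq i, ContinuousLinearMap.comp_apply]
  have hsplit : SJ f = f - SJc f :=
    eq_sub_of_add_eq
      ((HasSum.add_compl (f := fun i => P i f) (s := J) (hSJ f) (hSJc f)).unique (hparseval f))
  rw [hsum, hsplit]
  exact three_fourths_norm_sq_le_re_inner_sub_add f (SJc f)
end

section
/- Let Λ be a Parseval (C,C')-controlled g-frame for H, let J ⊆ ι, and suppose S_J and S_{J^c} are bounded operators on H such that for every f ∈ H the families (P_i f)_{i∈J} and (P_i f)_{i∈J^c} are summable in H with sums S_J f and S_{J^c} f respectively. Then 0 ≤ S_J − S_J² ≤ (1/4)·Id_H in the sense that for every f ∈ H, 0 ≤ Re⟨(S_J − S_J²) f, f⟩ ≤ (1/4)‖f‖². -/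
open ContinuousLinearMap in
/-- A symmetric operator `S` with `0 ≤ S ≤ 1` satisfies `0 ≤ S - S² ≤ 1/4`. -/
lemma re_inner_sub_comp_self_bounds {H : Type*} [NormedAddCommGroup H] [InnerProductSpace ℂ H]
    {S : H →L[ℂ] H} (hsymm : ∀ f g : H, inner ℂ (S f) g = inner ℂ f (S g))
    (hnonneg : ∀ f : H, 0 ≤ (inner ℂ (S f) f : ℂ).re)
    (hcompl : ∀ f : H, 0 ≤ (inner ℂ (f - S f) f : ℂ).re) (f : H) :
    0 ≤ (inner ℂ ((S - S.comp S) f) f : ℂ).re ∧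
      (inner ℂ ((S - S.comp S) f) f : ℂ).re ≤ (1 / 4) * ‖f‖ ^ 2 := by
  have norm_sq (x : H) : (inner ℂ x x : ℂ).re = ‖x‖ ^ 2 := inner_self_eq_norm_sq (𝕜 := ℂ) x
  have hSS : inner ℂ (S (S f)) f = inner ℂ (S f) (S f) := hsymm _ _
  have hval : (inner ℂ ((S - S.comp S) f) f : ℂ).re = (inner ℂ (S f) f : ℂ).re - ‖S f‖ ^ 2 := by
    simp only [sub_apply, comp_apply, inner_sub_left, Complex.sub_re, hSS, norm_sq]
  rw [hval]
  constructor
  · have h₁ := hcompl (S f)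
    have h₂ := hnonneg (f - S f)
    simp only [map_sub, inner_sub_left, inner_sub_right, Complex.sub_re, hSS, norm_sq] at h₁ h₂
    linarith
  · have h := norm_sub_sq (𝕜 := ℂ) (S f) ((1 / 2 : ℂ) • f)
    have hre : (inner ℂ (S f) ((1 / 2 : ℂ) • f) : ℂ).re = 1 / 2 * (inner ℂ (S f) f : ℂ).re := by
      simp
    have hnorm : ‖(1 / 2 : ℂ) • f‖ = 1 / 2 * ‖f‖ := by simp [norm_smul]
    rw [RCLike.re_eq_complex_re, hre, hnorm] at h
    nlinarith [sq_nonneg ‖S f - (1 / 2 : ℂ) • f‖]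

/-- A sum of vectors whose inner products with `f` have nonnegative real part has the same property. -/
lemma re_inner_nonneg_of_hasSum {H κ : Type*} [NormedAddCommGroup H] [InnerProductSpace ℂ H]
    {u : κ → H} {x f : H} (hu : HasSum u x) (hnonneg : ∀ k, 0 ≤ (inner ℂ (u k) f : ℂ).re) :
    0 ≤ (inner ℂ x f : ℂ).re := by
  have h : HasSum (fun k => (inner ℂ (u k) f : ℂ)) (inner ℂ x f) := by
    simpa using (hu.mapL (innerSL ℂ f)).star
  exact (Complex.hasSum_re h).nonneg hnonneg

/-- A pointwise sum of self-adjoint operators is symmetric. -/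
lemma inner_left_eq_inner_right_of_hasSum {H κ : Type*} [NormedAddCommGroup H]
    [InnerProductSpace ℂ H] [CompleteSpace H] {P : κ → H →L[ℂ] H} {S : H →L[ℂ] H}
    (hP : ∀ k, IsSelfAdjoint (P k)) (hS : ∀ f, HasSum (fun k => P k f) (S f)) (f g : H) :
    inner ℂ (S f) g = inner ℂ f (S g) := by
  have h₁ : HasSum (fun k => (inner ℂ (P k f) g : ℂ)) (inner ℂ (S f) g) := by
    simpa using ((hS f).mapL (innerSL ℂ g)).star
  have h₂ : HasSum (fun k => (inner ℂ f (P k g) : ℂ)) (inner ℂ f (S g)) := by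
    simpa using (hS g).mapL (innerSL ℂ f)
  have hterm (k : κ) : (inner ℂ (P k f) g : ℂ) = inner ℂ f (P k g) :=
    (hP k).isSymmetric f g
  simp only [hterm] at h₁
  exact h₁.unique h₂

/-- For a Parseval `(C,C')`-controlled g-frame with partial sum operators
`S_J`, `S_{J^c}`: `0 ≤ S_J − S_J² ≤ (1/4)·Id`, i.e. for every `f`,
`0 ≤ Re⟨(S_J − S_J²)f, f⟩ ≤ (1/4)‖f‖²`. -/
theorem stmt_15 {H : Type*} [NormedAddCommGroup H] [InnerProductSpace ℂ H] [CompleteSpace H]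
    {ι : Type*} {G : ι → Type*} [∀ i, NormedAddCommGroup (G i)]
    [∀ i, InnerProductSpace ℂ (G i)] [∀ i, CompleteSpace (G i)]
    (Λ : ∀ i, H →L[ℂ] G i) (C C' : H →L[ℂ] H)
    (hC : ∃ Ci : H →L[ℂ] H, Ci.comp C = 1 ∧ C.comp Ci = 1)
    (hC' : ∃ Ci : H →L[ℂ] H, Ci.comp C' = 1 ∧ C'.comp Ci = 1)
    (P : ι → H →L[ℂ] H)
    (hP : ∀ i, P i = (ContinuousLinearMap.adjoint C).comp
      ((ContinuousLinearMap.adjoint (Λ i)).comp ((Λ i).comp C')))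
    (hPsa : ∀ i, IsSelfAdjoint (P i))
    (hPpos : ∀ i, ∀ f : H, 0 ≤ (inner ℂ (P i f) f : ℂ).re)
    (Psqrt : ι → H →L[ℂ] H)
    (hPsqsa : ∀ i, IsSelfAdjoint (Psqrt i))
    (hPsqpos : ∀ i, ∀ f : H, 0 ≤ (inner ℂ (Psqrt i f) f : ℂ).re)
    (hPsq : ∀ i, (Psqrt i).comp (Psqrt i) = P i)
    (hparseval : ∀ f : H, HasSum (fun i => P i f) f)
    (J : Set ι) (SJ SJc : H →L[ℂ] H)
    (hSJ : ∀ f : H, HasSum (fun i : J => P (i : ι) f) (SJ f))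
    (hSJc : ∀ f : H, HasSum (fun i : ↥Jᶜ => P (i : ι) f) (SJc f)) :
    ∀ f : H, 0 ≤ (inner ℂ ((SJ - SJ.comp SJ) f) f : ℂ).re ∧
      (inner ℂ ((SJ - SJ.comp SJ) f) f : ℂ).re ≤ (1 / 4) * ‖f‖ ^ 2 := by
  have hadd (f : H) : f - SJ f = SJc f :=
    sub_eq_of_eq_add' ((hparseval f).unique ((hSJ f).add_compl (hSJc f)))
  refine re_inner_sub_comp_self_bounds
    (inner_left_eq_inner_right_of_hasSum (fun i : J => hPsa i) hSJ)
    (fun f => re_inner_nonneg_of_hasSum (hSJ f) fun i => hPpos i f) fun f => ?_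
  rw [hadd]
  exact re_inner_nonneg_of_hasSum (hSJc f) fun i => hPpos i f
end

section
/- Let Λ be a (C,C')-controlled g-frame for H with controlled g-frame operator S (bounded, positive, bijective with bounded inverse), and let S^{-1/2} denote the unique positive square root of S⁻¹. Assume S^{-1/2} commutes with C and with C'. Let J ⊆ ι and suppose S_J is a bounded operator on H such that for every f ∈ H the family (P_i f)_{i∈J} is summable in H with sum S_J f. Then 0 ≤ S_J − S_J S⁻¹ S_J ≤ (1/4)·S in the sense that for every f ∈ H, 0 ≤ Re⟨(S_J − S_J S⁻¹ S_J) f, f⟩ ≤ (1/4)·Re⟨S f, f⟩. -/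
/-- A pointwise unconditional sum of self-adjoint operators is symmetric. -/
lemma inner_hasSum_symm {H κ : Type*} [NormedAddCommGroup H] [InnerProductSpace ℂ H]
    [CompleteSpace H] {P : κ → H →L[ℂ] H} (hP : ∀ i, IsSelfAdjoint (P i)) {T : H →L[ℂ] H}
    (hT : ∀ f, HasSum (fun i => P i f) (T f)) (f g : H) :
    inner ℂ (T f) g = inner ℂ f (T g) := by
  have hfg : HasSum (fun i => inner ℂ f (P i g)) (inner ℂ f (T g)) :=
    (hT g).mapL (innerSL ℂ f)
  have hgf : HasSum (fun i => inner ℂ (P i f) g) (inner ℂ (T f) g) := by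
    have h : HasSum (fun i => inner ℂ g (P i f)) (inner ℂ g (T f)) := (hT f).mapL (innerSL ℂ g)
    simpa only [Function.comp_def, ← starRingEnd_apply, inner_conj_symm]
      using h.star
  exact hgf.unique ((funext fun i => (hP i).isSymmetric f g) ▸ hfg)

/-- The real quadratic form commutes with pointwise unconditional sums of operators. -/
lemma hasSum_re_inner_apply_self {H κ : Type*} [NormedAddCommGroup H] [InnerProductSpace ℂ H]
    {P : κ → H →L[ℂ] H} {T : H →L[ℂ] H} {f : H} (hT : HasSum (fun i => P i f) (T f)) :
    HasSum (fun i => (inner ℂ (P i f) f : ℂ).re) (inner ℂ (T f) f : ℂ).re := by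
  have h := (hT.mapL (innerSL ℂ f)).mapL Complex.reCLM
  have re_symm : ∀ x : H, (inner ℂ f x : ℂ).re = (inner ℂ x f : ℂ).re :=
    fun x => inner_re_symm (𝕜 := ℂ) f x
  simpa only [innerSL_apply_apply, Complex.reCLM_apply, re_symm] using h

/-- If `S g = T f` with `0 ≤ T ≤ S` symmetric, then
`0 ≤ ⟨T f - T g, f⟩ ≤ (1/4) ⟨S f, f⟩`. -/
lemma re_inner_sub_mem_Icc_of_le {H : Type*} [NormedAddCommGroup H] [InnerProductSpace ℂ H]
    {S T : H →L[ℂ] H} (hS : ∀ f g, inner ℂ (S f) g = inner ℂ f (S g))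
    (hT : ∀ f g, inner ℂ (T f) g = inner ℂ f (T g))
    (hT0 : ∀ f, 0 ≤ (inner ℂ (T f) f : ℂ).re)
    (hTS : ∀ f, (inner ℂ (T f) f : ℂ).re ≤ (inner ℂ (S f) f : ℂ).re)
    {f g : H} (hg : S g = T f) :
    (inner ℂ (T f - T g) f : ℂ).re ∈
      Set.Icc 0 ((1 / 4) * (inner ℂ (S f) f : ℂ).re) := by
  have re_symm : ∀ x y : H, (inner ℂ x y : ℂ).re = (inner ℂ y x : ℂ).re :=
    fun x y => inner_re_symm (𝕜 := ℂ) x y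
  have hTg : (inner ℂ (T g) f : ℂ).re = (inner ℂ (T f) g : ℂ).re := by rw [hT, re_symm]
  have hSg : (inner ℂ (S f) g : ℂ).re = (inner ℂ (T f) f : ℂ).re := by rw [hS, hg, re_symm]
  have lower := hT0 (f - g)
  have hle := hTS g
  have upper := (hT0 (f - (2 : ℂ) • g)).trans (hTS (f - (2 : ℂ) • g))
  simp only [map_sub, map_smul, inner_sub_left, inner_sub_right, inner_smul_left,
    inner_smul_right, Complex.sub_re, Complex.mul_re, hg, map_ofNat, Complex.re_ofNat,
    Complex.im_ofNat, zero_mul, sub_zero] at lower upper hle ⊢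
  constructor <;> linarith

/-- For a `(C,C')`-controlled g-frame whose frame operator `S` has positive
square root `S^{-1/2}` of `S⁻¹` commuting with `C` and `C'`, and partial sum operator `S_J`:
`0 ≤ S_J − S_J S⁻¹ S_J ≤ (1/4)·S`, i.e. for every `f`,
`0 ≤ Re⟨(S_J − S_J S⁻¹ S_J)f, f⟩ ≤ (1/4)·Re⟨Sf, f⟩`. -/
theorem stmt_17 {H : Type*} [NormedAddCommGroup H] [InnerProductSpace ℂ H] [CompleteSpace H]
    {ι : Type*} {G : ι → Type*} [∀ i, NormedAddCommGroup (G i)]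
    [∀ i, InnerProductSpace ℂ (G i)] [∀ i, CompleteSpace (G i)]
    (Λ : ∀ i, H →L[ℂ] G i) (C C' : H →L[ℂ] H)
    (hC : ∃ Ci : H →L[ℂ] H, Ci.comp C = 1 ∧ C.comp Ci = 1)
    (hC' : ∃ Ci : H →L[ℂ] H, Ci.comp C' = 1 ∧ C'.comp Ci = 1)
    (P : ι → H →L[ℂ] H)
    (hP : ∀ i, P i = (ContinuousLinearMap.adjoint C).comp
      ((ContinuousLinearMap.adjoint (Λ i)).comp ((Λ i).comp C')))
    (hPsa : ∀ i, IsSelfAdjoint (P i))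
    (hPpos : ∀ i, ∀ f : H, 0 ≤ (inner ℂ (P i f) f : ℂ).re)
    (Psqrt : ι → H →L[ℂ] H)
    (hPsqsa : ∀ i, IsSelfAdjoint (Psqrt i))
    (hPsqpos : ∀ i, ∀ f : H, 0 ≤ (inner ℂ (Psqrt i f) f : ℂ).re)
    (hPsq : ∀ i, (Psqrt i).comp (Psqrt i) = P i)
    (A B : ℝ) (hA : 0 < A) (hAB : A ≤ B)
    (hframe : ∀ f : H, Summable (fun i => ‖Psqrt i f‖ ^ 2) ∧
      A * ‖f‖ ^ 2 ≤ ∑' i, ‖Psqrt i f‖ ^ 2 ∧ (∑' i, ‖Psqrt i f‖ ^ 2) ≤ B * ‖f‖ ^ 2)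
    (S : H →L[ℂ] H) (hS : ∀ f : H, HasSum (fun i => P i f) (S f))
    (hSsa : IsSelfAdjoint S) (hSpos : ∀ f : H, 0 ≤ (inner ℂ (S f) f : ℂ).re)
    (Sinv : H →L[ℂ] H) (hSinv : Sinv.comp S = 1 ∧ S.comp Sinv = 1)
    (R : H →L[ℂ] H) (hRsa : IsSelfAdjoint R)
    (hRpos : ∀ f : H, 0 ≤ (inner ℂ (R f) f : ℂ).re)
    (hRsq : R.comp R = Sinv)
    (hRC : R.comp C = C.comp R) (hRC' : R.comp C' = C'.comp R)
    (J : Set ι) (SJ : H →L[ℂ] H)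
    (hSJ : ∀ f : H, HasSum (fun i : J => P (i : ι) f) (SJ f)) :
    ∀ f : H, 0 ≤ (inner ℂ ((SJ - SJ.comp (Sinv.comp SJ)) f) f : ℂ).re ∧
      (inner ℂ ((SJ - SJ.comp (Sinv.comp SJ)) f) f : ℂ).re ≤ (1 / 4) * (inner ℂ (S f) f : ℂ).re := by
  intro f
  have hTS : ∀ h, (inner ℂ (SJ h) h : ℂ).re ≤ (inner ℂ (S h) h : ℂ).re := fun h =>
    hasSum_le_inj ((↑) : J → ι) Subtype.val_injective (fun i _ => hPpos i h) (fun _ => le_rfl)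
      (hasSum_re_inner_apply_self (P := fun i : J => P i) (hSJ h))
      (hasSum_re_inner_apply_self (hS h))
  have hT0 : ∀ h, 0 ≤ (inner ℂ (SJ h) h : ℂ).re := fun h =>
    HasSum.nonneg (fun i : J => hPpos i h)
      (hasSum_re_inner_apply_self (P := fun i : J => P i) (hSJ h))
  exact re_inner_sub_mem_Icc_of_le hSsa.isSymmetric
    (inner_hasSum_symm (fun i : J => hPsa i) hSJ) hT0 hTS
    (DFunLike.congr_fun hSinv.2 (SJ f))
end

section
/- Let Λ be a (C,C')-controlled g-frame for H with controlled g-frame operator S (bounded, positive, bijective with bounded inverse), and let S^{-1/2} denote the unique positive square root of S⁻¹. Assume S^{-1/2} commutes with C and with C'. Let J ⊆ ι and suppose S_{J^c} is a bounded operator on H such that for every f ∈ H the family (P_i f)_{i∈J^c} is summable in H with sum S_{J^c} f. Then for every f ∈ H: Σ_{i∈J} ‖P_i^{1/2} f‖² + ‖S^{-1/2} S_{J^c} f‖² ≥ (3/4)·‖S⁻¹‖⁻¹·‖f‖². -/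
/-- If `Q i` is a self-adjoint square root of `P i` and `∑ P i f = s`, then
`∑ ‖Q i f‖² = Re ⟪f, s⟫`. -/
theorem hasSum_norm_sq_of_hasSum_comp_self {H κ : Type*} [NormedAddCommGroup H]
    [InnerProductSpace ℂ H] [CompleteSpace H] {P Q : κ → H →L[ℂ] H}
    (hQ : ∀ i, IsSelfAdjoint (Q i)) (hQP : ∀ i, (Q i).comp (Q i) = P i) {f s : H}
    (hs : HasSum (fun i => P i f) s) :
    HasSum (fun i => ‖Q i f‖ ^ 2) (inner ℂ f s : ℂ).re := by
  have h := (hs.mapL (innerSL ℂ f)).mapL Complex.reCLM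
  refine Eq.subst (motive := fun F => HasSum F _) (funext fun i => ?_) h
  have hsymm : (inner ℂ f (Q i (Q i f)) : ℂ) = inner ℂ (Q i f) (Q i f) :=
    ((hQ i).isSymmetric f (Q i f)).symm
  simp only [← hQP i, innerSL_apply_apply, Complex.reCLM_apply,
    ContinuousLinearMap.comp_apply, hsymm]
  exact inner_self_eq_norm_sq (𝕜 := ℂ) (Q i f)

/-- `(3/4)‖g‖² ≤ ‖g‖² - Re ⟪g, u⟫ + ‖u‖²`. -/
theorem three_quarters_norm_sq_le {H : Type*} [NormedAddCommGroup H] [InnerProductSpace ℂ H]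
    (g u : H) : 3 / 4 * ‖g‖ ^ 2 ≤ ‖g‖ ^ 2 - (inner ℂ g u : ℂ).re + ‖u‖ ^ 2 := by
  have h : (inner ℂ g u : ℂ).re ≤ ‖g‖ * ‖u‖ := re_inner_le_norm (𝕜 := ℂ) g u
  nlinarith [sq_nonneg (‖g‖ / 2 - ‖u‖)]

/-- A self-adjoint operator satisfies `‖R g‖² ≤ ‖R ∘ R‖ ‖g‖²`. -/
theorem IsSelfAdjoint.norm_apply_sq_le {H : Type*} [NormedAddCommGroup H]
    [InnerProductSpace ℂ H] [CompleteSpace H] {R : H →L[ℂ] H} (hR : IsSelfAdjoint R) (g : H) :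
    ‖R g‖ ^ 2 ≤ ‖R.comp R‖ * ‖g‖ ^ 2 := by
  have h : ‖R.comp R‖ = ‖R‖ ^ 2 := by
    simpa [sq, hR.star_eq, ContinuousLinearMap.mul_def] using CStarRing.norm_star_mul_self (x := R)
  rw [h, ← mul_pow]
  gcongr
  exact R.le_opNorm g

/-- For a `(C,C')`-controlled g-frame whose frame operator `S` has positive
square root `S^{-1/2}` of `S⁻¹` commuting with `C` and `C'`, and partial sum operator
`S_{J^c}`: for every `f`,
`Σ_{i∈J} ‖P_i^{1/2}f‖² + ‖S^{-1/2} S_{J^c} f‖² ≥ (3/4)·‖S⁻¹‖⁻¹·‖f‖²`. -/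
theorem stmt_18 {H : Type*} [NormedAddCommGroup H] [InnerProductSpace ℂ H] [CompleteSpace H]
    {ι : Type*} {G : ι → Type*} [∀ i, NormedAddCommGroup (G i)]
    [∀ i, InnerProductSpace ℂ (G i)] [∀ i, CompleteSpace (G i)]
    (Λ : ∀ i, H →L[ℂ] G i) (C C' : H →L[ℂ] H)
    (hC : ∃ Ci : H →L[ℂ] H, Ci.comp C = 1 ∧ C.comp Ci = 1)
    (hC' : ∃ Ci : H →L[ℂ] H, Ci.comp C' = 1 ∧ C'.comp Ci = 1)
    (P : ι → H →L[ℂ] H)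
    (hP : ∀ i, P i = (ContinuousLinearMap.adjoint C).comp
      ((ContinuousLinearMap.adjoint (Λ i)).comp ((Λ i).comp C')))
    (hPsa : ∀ i, IsSelfAdjoint (P i))
    (hPpos : ∀ i, ∀ f : H, 0 ≤ (inner ℂ (P i f) f : ℂ).re)
    (Psqrt : ι → H →L[ℂ] H)
    (hPsqsa : ∀ i, IsSelfAdjoint (Psqrt i))
    (hPsqpos : ∀ i, ∀ f : H, 0 ≤ (inner ℂ (Psqrt i f) f : ℂ).re)
    (hPsq : ∀ i, (Psqrt i).comp (Psqrt i) = P i)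
    (A B : ℝ) (hA : 0 < A) (hAB : A ≤ B)
    (hframe : ∀ f : H, Summable (fun i => ‖Psqrt i f‖ ^ 2) ∧
      A * ‖f‖ ^ 2 ≤ ∑' i, ‖Psqrt i f‖ ^ 2 ∧ (∑' i, ‖Psqrt i f‖ ^ 2) ≤ B * ‖f‖ ^ 2)
    (S : H →L[ℂ] H) (hS : ∀ f : H, HasSum (fun i => P i f) (S f))
    (hSsa : IsSelfAdjoint S) (hSpos : ∀ f : H, 0 ≤ (inner ℂ (S f) f : ℂ).re)
    (Sinv : H →L[ℂ] H) (hSinv : Sinv.comp S = 1 ∧ S.comp Sinv = 1)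
    (R : H →L[ℂ] H) (hRsa : IsSelfAdjoint R)
    (hRpos : ∀ f : H, 0 ≤ (inner ℂ (R f) f : ℂ).re)
    (hRsq : R.comp R = Sinv)
    (hRC : R.comp C = C.comp R) (hRC' : R.comp C' = C'.comp R)
    (J : Set ι) (SJc : H →L[ℂ] H)
    (hSJc : ∀ f : H, HasSum (fun i : ↥Jᶜ => P (i : ι) f) (SJc f)) :
    ∀ f : H, (3 / 4) * ‖Sinv‖⁻¹ * ‖f‖ ^ 2 ≤
      (∑' i : J, ‖Psqrt (i : ι) f‖ ^ 2) + ‖R (SJc f)‖ ^ 2 := by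
  intro f
  have hsum := hasSum_norm_sq_of_hasSum_comp_self hPsqsa hPsq (hS f)
  have hsumJc := hasSum_norm_sq_of_hasSum_comp_self (fun i : ↥Jᶜ => hPsqsa i)
    (fun i : ↥Jᶜ => hPsq i) (hSJc f)
  have hsplit := (hsum.summable.subtype J).tsum_add_tsum_compl (hsum.summable.subtype Jᶜ)
  rw [hsum.tsum_eq, hsumJc.tsum_eq] at hsplit
  set g := R (S f)
  have hf : R g = f := by
    have h := congrArg (fun T : H →L[ℂ] H => T f) hSinv.1
    simpa [← hRsq] using h
  have hinner : ∀ x : H, (inner ℂ f x : ℂ) = inner ℂ g (R x) := fun x => by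
    conv_lhs => rw [← hf]
    exact hRsa.isSymmetric g x
  have hgg : (inner ℂ g (R (S f)) : ℂ).re = ‖g‖ ^ 2 := inner_self_eq_norm_sq (𝕜 := ℂ) g
  rw [hinner, hinner, hgg] at hsplit
  have hnorm : ‖Sinv‖⁻¹ * ‖f‖ ^ 2 ≤ ‖g‖ ^ 2 := by
    have h := hRsa.norm_apply_sq_le g
    rw [hf, hRsq] at h
    rcases (norm_nonneg Sinv).eq_or_lt with h0 | h0
    · simp [← h0]
    · exact (inv_mul_le_iff₀ h0).2 h
  linarith [three_quarters_norm_sq_le g (R (SJc f))]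
end

section
/- Let Λ be a Parseval (C,C')-controlled g-frame for H, let J ⊆ ι, and suppose S_J and S_{J^c} are bounded operators on H such that for every f ∈ H the families (P_i f)_{i∈J} and (P_i f)_{i∈J^c} are summable in H with sums S_J f and S_{J^c} f respectively. Then (1/2)·Id_H ≤ S_J² + S_{J^c}² ≤ (3/2)·Id_H in the sense that for every f ∈ H, (1/2)‖f‖² ≤ Re⟨(S_J² + S_{J^c}²) f, f⟩ ≤ (3/2)‖f‖². -/
/-- A pointwise unconditional sum of self-adjoint operators is symmetric. -/
lemma inner_apply_eq_of_hasSum {H κ : Type*} [NormedAddCommGroup H] [InnerProductSpace ℂ H]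
    [CompleteSpace H] {Q : κ → H →L[ℂ] H} {S : H →L[ℂ] H} (hQ : ∀ i, IsSelfAdjoint (Q i))
    (hS : ∀ f, HasSum (fun i => Q i f) (S f)) (f g : H) :
    inner ℂ (S f) g = inner ℂ f (S g) := by
  have hl := (hS f).map (innerSLFlip ℂ g) (innerSLFlip ℂ g).continuous
  have hr := (hS g).map (innerSL ℂ f) (innerSL ℂ f).continuous
  refine hl.unique (hr.congr_fun ?_)
  intro i
  simpa using (hQ i).isSymmetric f g

/-- A pointwise unconditional sum of positive operators is positive. -/
lemma re_inner_nonneg_of_hasSum_s19 {H κ : Type*} [NormedAddCommGroup H] [InnerProductSpace ℂ H]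
    {Q : κ → H →L[ℂ] H} {S : H →L[ℂ] H}
    (hQ : ∀ i f, 0 ≤ (inner ℂ (Q i f) f : ℂ).re)
    (hS : ∀ f, HasSum (fun i => Q i f) (S f)) (f : H) :
    0 ≤ (inner ℂ (S f) f : ℂ).re :=
  (Complex.hasSum_re ((hS f).map (innerSLFlip ℂ f) (innerSLFlip ℂ f).continuous)).nonneg
    fun i => hQ i f

/-- If `S` is symmetric and both `S` and `1 - S` are positive, then `‖S f‖² ≤ Re ⟪S f, f⟫`. -/
lemma norm_sq_apply_le_re_inner {H : Type*} [NormedAddCommGroup H] [InnerProductSpace ℂ H]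
    {S : H →L[ℂ] H} (hsymm : ∀ f g, inner ℂ (S f) g = inner ℂ f (S g))
    (hpos : ∀ f, 0 ≤ (inner ℂ (S f) f : ℂ).re)
    (hcompl : ∀ f, 0 ≤ (inner ℂ (f - S f) f : ℂ).re) (f : H) :
    ‖S f‖ ^ 2 ≤ (inner ℂ (S f) f : ℂ).re := by
  have h₁ := hpos (f - S f)
  have h₂ := hcompl (S f)
  have h₃ : (inner ℂ (S f) (S f) : ℂ).re = ‖S f‖ ^ 2 := inner_self_eq_norm_sq (𝕜 := ℂ) (S f)
  simp only [map_sub, inner_sub_left, inner_sub_right, Complex.sub_re, hsymm (S f) f] at h₁ h₂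
  linarith

/-- For a Parseval `(C,C')`-controlled g-frame with partial sum operators
`S_J`, `S_{J^c}`: `(1/2)·Id ≤ S_J² + S_{J^c}² ≤ (3/2)·Id`, i.e. for every `f`,
`(1/2)‖f‖² ≤ Re⟨(S_J² + S_{J^c}²)f, f⟩ ≤ (3/2)‖f‖²`. -/
theorem stmt_19 {H : Type*} [NormedAddCommGroup H] [InnerProductSpace ℂ H] [CompleteSpace H]
    {ι : Type*} {G : ι → Type*} [∀ i, NormedAddCommGroup (G i)]
    [∀ i, InnerProductSpace ℂ (G i)] [∀ i, CompleteSpace (G i)]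
    (Λ : ∀ i, H →L[ℂ] G i) (C C' : H →L[ℂ] H)
    (hC : ∃ Ci : H →L[ℂ] H, Ci.comp C = 1 ∧ C.comp Ci = 1)
    (hC' : ∃ Ci : H →L[ℂ] H, Ci.comp C' = 1 ∧ C'.comp Ci = 1)
    (P : ι → H →L[ℂ] H)
    (hP : ∀ i, P i = (ContinuousLinearMap.adjoint C).comp
      ((ContinuousLinearMap.adjoint (Λ i)).comp ((Λ i).comp C')))
    (hPsa : ∀ i, IsSelfAdjoint (P i))
    (hPpos : ∀ i, ∀ f : H, 0 ≤ (inner ℂ (P i f) f : ℂ).re)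
    (Psqrt : ι → H →L[ℂ] H)
    (hPsqsa : ∀ i, IsSelfAdjoint (Psqrt i))
    (hPsqpos : ∀ i, ∀ f : H, 0 ≤ (inner ℂ (Psqrt i f) f : ℂ).re)
    (hPsq : ∀ i, (Psqrt i).comp (Psqrt i) = P i)
    (hparseval : ∀ f : H, HasSum (fun i => P i f) f)
    (J : Set ι) (SJ SJc : H →L[ℂ] H)
    (hSJ : ∀ f : H, HasSum (fun i : J => P (i : ι) f) (SJ f))
    (hSJc : ∀ f : H, HasSum (fun i : ↥Jᶜ => P (i : ι) f) (SJc f)) :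
    ∀ f : H, (1 / 2) * ‖f‖ ^ 2 ≤ (inner ℂ ((SJ.comp SJ + SJc.comp SJc) f) f : ℂ).re ∧
      (inner ℂ ((SJ.comp SJ + SJc.comp SJc) f) f : ℂ).re ≤ (3 / 2) * ‖f‖ ^ 2 := by
  intro f
  have hadd (g : H) : SJc g = g - SJ g :=
    have h := HasSum.add_compl (f := fun i => P i g) (s := J) (hSJ g) (hSJc g)
    eq_sub_of_add_eq' (h.unique (hparseval g))
  have hsymm := inner_apply_eq_of_hasSum (fun i : J => hPsa i) hSJ
  have hpos := re_inner_nonneg_of_hasSum_s19 (fun i : J => hPpos i) hSJ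
  have hcompl := re_inner_nonneg_of_hasSum_s19 (fun i : ↥Jᶜ => hPpos i) hSJc
  simp only [hadd] at hcompl
  have hle := norm_sq_apply_le_re_inner hsymm hpos hcompl f
  have hself (g : H) : (inner ℂ g g : ℂ).re = ‖g‖ ^ 2 := inner_self_eq_norm_sq (𝕜 := ℂ) g
  have hre : (inner ℂ f (SJ f) : ℂ).re = (inner ℂ (SJ f) f : ℂ).re := by rw [hsymm f f]
  have hsum : (inner ℂ ((SJ.comp SJ + SJc.comp SJc) f) f : ℂ).re =
      2 * ‖SJ f‖ ^ 2 - 2 * (inner ℂ (SJ f) f : ℂ).re + ‖f‖ ^ 2 := by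
    simp only [add_apply, ContinuousLinearMap.comp_apply, hadd, map_sub,
      inner_add_left, inner_sub_left, Complex.add_re, Complex.sub_re, hsymm (SJ f) f, hself]
    ring
  have hhalf : 0 ≤ ‖(2 : ℂ) • SJ f - f‖ ^ 2 := sq_nonneg _
  rw [← hself] at hhalf
  simp only [inner_sub_left, inner_sub_right, inner_smul_left, inner_smul_right, Complex.sub_re,
    Complex.mul_re, map_ofNat, Complex.re_ofNat, Complex.im_ofNat, zero_mul, sub_zero, hself,
    hre] at hhalf
  rw [hsum]
  constructor
  · linarith
  · linarith [sq_nonneg ‖f‖]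
end
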